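/- Let n ≥ 2 and t = (t_1, …, t_n) be a tuple of integers. The following are equivalent: (A) t is not ordered, and there exists an index m with 1 ≤ m ≤ n such that the tuple obtained from t by removing the m-th term is ordered; (B) there exists p with 1 ≤ p ≤ n−1 such that t is (p, n−p)-dominant, the set {i : 1 ≤ i ≤ p and t_i ≤ t_{p+1}} is nonempty, and, writing i_1 for its smallest element, if i_1 ≠ p and p+2 ≤ n then t_p > t_{p+2}. -/

import Mathlib

/-- A sequence that decreases at every consecutive step of `{1, …, n}` is strictly decreasing
there. -/
theorem lt_of_forall_succ_lt {n : ℕ} {t : ℕ → ℤ}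
    (h : ∀ p, 1 ≤ p → p + 1 ≤ n → t (p + 1) < t p) {i j : ℕ} (hi : 1 ≤ i) (hij : i < j)
    (hj : j ≤ n) : t j < t i := by
  induction j, hij using Nat.le_induction with
  | base => exact h i hi hj
  | succ k hk ih => exact (h k (by omega) hj).trans (ih (by omega))

/-- Let `n ≥ 2` and `t = (t 1, …, t n)` be a tuple of integers.  The tuple is
*ordered* iff it is strictly decreasing on `{1, …, n}`, and it is
*(p, n−p)-dominant* iff it is strictly decreasing on `{1, …, p}` and on
`{p+1, …, n}` (all differences of integers are automatically integral).
The following are equivalent: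
(A) `t` is not ordered, and there is an index `m` with `1 ≤ m ≤ n` such that
the tuple obtained from `t` by removing the `m`-th term is ordered (i.e. `t`
is strictly decreasing on `{1, …, n} \ {m}`);
(B) there exists `p` with `1 ≤ p ≤ n−1` such that `t` is `(p, n−p)`-dominant,
the set `{i : 1 ≤ i ≤ p, t i ≤ t (p+1)}` is nonempty and, `i₁` denoting its
smallest element, if `i₁ ≠ p` and `p+2 ≤ n` then `t p > t (p+2)`. -/
theorem stmt_3 (n : ℕ) (hn : 2 ≤ n) (t : ℕ → ℤ) :
    ((¬ ∀ i j, 1 ≤ i → i < j → j ≤ n → t j < t i) ∧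
      ∃ m, 1 ≤ m ∧ m ≤ n ∧
        ∀ i j, 1 ≤ i → i < j → j ≤ n → i ≠ m → j ≠ m → t j < t i)
    ↔
    (∃ p, 1 ≤ p ∧ p ≤ n - 1 ∧
      (∀ i j, 1 ≤ i → i < j → j ≤ p → t j < t i) ∧
      (∀ i j, p + 1 ≤ i → i < j → j ≤ n → t j < t i) ∧
      ∃ i₁, 1 ≤ i₁ ∧ i₁ ≤ p ∧ t i₁ ≤ t (p + 1) ∧
        (∀ i, 1 ≤ i → i ≤ p → t i ≤ t (p + 1) → i₁ ≤ i) ∧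
        (i₁ ≠ p → p + 2 ≤ n → t (p + 2) < t p)) := by
  constructor
  · rintro ⟨hnot, m, hm1, hmn, hm⟩
    obtain ⟨p, hp1, hpn, hp⟩ : ∃ p, 1 ≤ p ∧ p + 1 ≤ n ∧ t p ≤ t (p + 1) := by
      by_contra! h
      exact hnot fun i j hi hij hj => lt_of_forall_succ_lt h hi hij hj
    have hpm : p = m ∨ p + 1 = m := by
      by_contra! h
      exact (hm p (p + 1) hp1 (by omega) hpn h.1 h.2).not_ge hp
    refine ⟨p, hp1, by omega, ?_, ?_, ?_⟩
    · intro i j hi hij hj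
      by_cases hjm : j = m
      · obtain rfl : p = j := by omega
        have := hm i (p + 1) hi (by omega) hpn (by omega) (by omega)
        omega
      · exact hm i j hi hij (by omega) (by omega) hjm
    · intro i j hi hij hj
      by_cases him : i = m
      · obtain rfl : i = p + 1 := by omega
        have := hm p j hp1 (by omega) hj (by omega) (by omega)
        omega
      · exact hm i j (by omega) hij hj him (by omega)
    · have hex : ∃ i, 1 ≤ i ∧ i ≤ p ∧ t i ≤ t (p + 1) := ⟨p, hp1, le_rfl, hp⟩
      obtain ⟨h1, h2, h3⟩ := Nat.find_spec hex
      refine ⟨Nat.find hex, h1, h2, h3, fun i hi hip hti => Nat.find_min' hex ⟨hi, hip, hti⟩, ?_⟩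
      intro hne hp2
      rcases hpm with rfl | rfl
      · have := hm (Nat.find hex) (p + 1) h1 (by omega) hpn hne (by omega)
        omega
      · exact hm p (p + 2) hp1 (by omega) hp2 (by omega) (by omega)
  · rintro ⟨p, hp1, hpn, hl, hr, k, hk1, hkp, hk, hmin, hlast⟩
    refine ⟨fun h => (h k (p + 1) hk1 (by omega) (by omega)).not_ge hk, ?_⟩
    by_cases hkp' : k = p
    · refine ⟨p, hp1, by omega, fun i j hi hij hj hip hjp => ?_⟩
      rcases Nat.lt_or_ge p j with hj' | hj'
      · rcases Nat.lt_or_ge p i with hi' | hi'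
        · exact hr i j hi' hij hj
        · have h1 : t (p + 1) < t i := by
            by_contra! h
            have := hmin i hi hi' h
            omega
          rcases (show p + 1 ≤ j from hj').eq_or_lt with rfl | hlt
          · exact h1
          · exact (hr (p + 1) j le_rfl hlt hj).trans h1
      · exact hl i j hi hij hj'
    · refine ⟨p + 1, by omega, by omega, fun i j hi hij hj hip hjp => ?_⟩
      rcases Nat.lt_or_ge p j with hj' | hj'
      · rcases Nat.lt_or_ge p i with hi' | hi'
        · exact hr i j hi' hij hj
        · have h1 : t p ≤ t i := by
            rcases hi'.eq_or_lt with rfl | hlt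
            · exact le_rfl
            · exact (hl i p hi hlt le_rfl).le
          have h2 : t j ≤ t (p + 2) := by
            rcases (show p + 2 ≤ j by omega).eq_or_lt with rfl | hlt
            · exact le_rfl
            · exact (hr (p + 2) j (by omega) hlt hj).le
          exact (h2.trans_lt (hlast hkp' (by omega))).trans_le h1
      · exact hl i j hi hij hj'
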